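/- Let R = S ×_k T be a non-trivial fiber product and let C be a semidualizing R-module, i.e., a finitely generated R-module such that the homothety map R → Hom_R(C, C) is an isomorphism and Ext_R^i(C, C) = 0 for all i ≥ 1. Then C ≅ R as R-modules, or C has finite injective dimension over R (i.e., C is a dualizing module for R). -/

import Mathlib

open CategoryTheory Opposite IsLocalRing

noncomputable section

set_option maxHeartbeats 1000000
set_option synthInstance.maxHeartbeats 1000000

/-- Vanishing of `Tor_i^A(M, N)`. -/
abbrev TorZero (A : Type) [CommRing A] (M N : Type) [AddCommGroup M] [Module A M]
    [AddCommGroup N] [Module A N] (i : ℕ) : Prop :=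
  Subsingleton (((Tor (ModuleCat A) i).obj (ModuleCat.of A M)).obj (ModuleCat.of A N))

/-- Vanishing of `Ext^i_A(M, N)`. -/
abbrev ExtZero (A : Type) [CommRing A] (M N : Type) [AddCommGroup M] [Module A M]
    [AddCommGroup N] [Module A N] (i : ℕ) : Prop :=
  Subsingleton (((Ext A (ModuleCat A) i).obj (op (ModuleCat.of A M))).obj (ModuleCat.of A N))

/-- `M` has projective dimension at most `n` over `A`:
`Ext^i_A(M, -) = 0` for all `i > n`. -/
def PdLE (A : Type) [CommRing A] (M : Type) [AddCommGroup M] [Module A M] (n : ℕ) : Prop :=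
  ∀ (N : ModuleCat A) (i : ℕ), n < i →
    Subsingleton (((Ext A (ModuleCat A) i).obj (op (ModuleCat.of A M))).obj N)

/-- `N` has injective dimension at most `n` over `A`:
`Ext^i_A(-, N) = 0` for all `i > n`. -/
def IdLE (A : Type) [CommRing A] (N : Type) [AddCommGroup N] [Module A N] (n : ℕ) : Prop :=
  ∀ (X : ModuleCat A) (i : ℕ), n < i →
    Subsingleton (((Ext A (ModuleCat A) i).obj (op X)).obj (ModuleCat.of A N))

/-- The depth of a module over a noetherian local ring, as an extended natural number:
`inf { i | Ext^i_A(k, M) ≠ 0 }`. -/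
def depthM (A : Type) [CommRing A] [IsLocalRing A] (M : Type) [AddCommGroup M]
    [Module A M] : ℕ∞ :=
  sInf {n : ℕ∞ | ∃ i : ℕ, n = i ∧
    ¬ Subsingleton (((Ext A (ModuleCat A) i).obj
        (op (ModuleCat.of A (A ⧸ maximalIdeal A)))).obj (ModuleCat.of A M))}

/-- The fiber product `S ×ₖ T` as a subring of `S × T`. -/
def fiberProd {S T k : Type} [CommRing S] [CommRing T] [CommRing k]
    (πS : S →+* k) (πT : T →+* k) : Subring (S × T) :=
  RingHom.eqLocus (πS.comp (RingHom.fst S T)) (πT.comp (RingHom.snd S T))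

/-- The projection from the fiber product to `S`. -/
def ρS {S T k : Type} [CommRing S] [CommRing T] [CommRing k]
    (πS : S →+* k) (πT : T →+* k) : ↥(fiberProd πS πT) →+* S :=
  (RingHom.fst S T).comp (fiberProd πS πT).subtype

/-- The projection from the fiber product to `T`. -/
def ρT {S T k : Type} [CommRing S] [CommRing T] [CommRing k]
    (πS : S →+* k) (πT : T →+* k) : ↥(fiberProd πS πT) →+* T :=
  (RingHom.snd S T).comp (fiberProd πS πT).subtype

/-- The `i`-th Betti number of a module `M` over a noetherian local ring `A`:
the `k`-dimension of `Tor_i^A(M, k) ⊗_A k`; since `Tor_i^A(M, k)` is annihilated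
by the maximal ideal, this is `dim_k Tor_i^A(M, k)`. -/
noncomputable def betti (A : Type) [CommRing A] [IsLocalRing A] (M : Type) [AddCommGroup M]
    [Module A M] (i : ℕ) : ℕ :=
  let X : ModuleCat A :=
    ((Tor (ModuleCat A) i).obj (ModuleCat.of A M)).obj (ModuleCat.of A (A ⧸ maximalIdeal A))
  Module.finrank (A ⧸ maximalIdeal A) (X ⧸ (maximalIdeal A • (⊤ : Submodule A X)))

/-- `M` is a first syzygy over `A` of a finitely generated `A`-module, i.e. `M` embeds
into a finite free `A`-module (as the kernel of `F ↠ L` for the quotient `L`). -/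
def IsFirstSyzygy (A : Type) [CommRing A] (M : Type) [AddCommGroup M] [Module A M] : Prop :=
  ∃ (n : ℕ) (f : M →ₗ[A] (Fin n → A)), Function.Injective f
lemma subsingleton_ext_succ_iff {A : Type} [CommRing A] (X Y : ModuleCat.{0} A) (n : ℕ) :
    Subsingleton (((Ext A (ModuleCat A) (n + 1)).obj (op X)).obj Y) ↔
      Subsingleton (Abelian.Ext.{0} X Y (n + 1)) := by
  let P := projectiveResolution X
  rw [← ModuleCat.isZero_iff_subsingleton, (P.isoExt (n + 1) Y).isZero_iff,
    ← HomologicalComplex.exactAt_iff_isZero_homology,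
    HomologicalComplex.exactAt_iff' _ n (n + 1) (n + 2) (by simp) (by simp),
    ShortComplex.moduleCat_exact_iff]
  constructor
  · intro h
    refine subsingleton_of_forall_eq 0 fun a => ?_
    obtain ⟨f, hf, rfl⟩ := P.extMk_surjective a (n + 2) rfl
    rw [P.extMk_eq_zero_iff f (n + 2) rfl hf n rfl]
    exact h f hf
  · intro h f hf
    exact (P.extMk_eq_zero_iff f (n + 2) rfl hf n rfl).1 (Subsingleton.elim _ _)

/-- The group `Ext^i_A(M, N)`. -/
abbrev ModExt (A : Type) [CommRing A] (M N : Type) [AddCommGroup M] [Module A M]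
    [AddCommGroup N] [Module A N] (i : ℕ) : Type :=
  Abelian.Ext.{0} (ModuleCat.of A M) (ModuleCat.of A N) i

section ExtLemmas

variable {A : Type} [CommRing A] {M M' N : Type} [AddCommGroup M] [Module A M]
  [AddCommGroup M'] [Module A M'] [AddCommGroup N] [Module A N]

lemma subsingleton_modExt_of_retract (f : M' →ₗ[A] M) (g : M →ₗ[A] M')
    (h : g ∘ₗ f = LinearMap.id) {i : ℕ} (hM : Subsingleton (ModExt A M N i)) :
    Subsingleton (ModExt A M' N i) := by
  refine subsingleton_of_forall_eq 0 fun x => ?_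
  have hx : (Abelian.Ext.mk₀ (ModuleCat.ofHom f)).comp
      ((Abelian.Ext.mk₀ (ModuleCat.ofHom g)).comp x (zero_add i)) (zero_add i) = x := by
    rw [Abelian.Ext.mk₀_comp_mk₀_assoc, ← ModuleCat.ofHom_comp, h, ModuleCat.ofHom_id,
      Abelian.Ext.mk₀_id_comp]
  rw [← hx, Subsingleton.elim ((Abelian.Ext.mk₀ (ModuleCat.ofHom g)).comp x (zero_add i)) 0,
    Abelian.Ext.comp_zero]

lemma subsingleton_modExt_of_sum {M₁ M₂ : Type} [AddCommGroup M₁] [Module A M₁]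
    [AddCommGroup M₂] [Module A M₂] (f₁ : M →ₗ[A] M₁) (g₁ : M₁ →ₗ[A] M)
    (f₂ : M →ₗ[A] M₂) (g₂ : M₂ →ₗ[A] M) (h : g₁ ∘ₗ f₁ + g₂ ∘ₗ f₂ = LinearMap.id) {i : ℕ}
    (h₁ : Subsingleton (ModExt A M₁ N i)) (h₂ : Subsingleton (ModExt A M₂ N i)) :
    Subsingleton (ModExt A M N i) := by
  refine subsingleton_of_forall_eq 0 fun x => ?_
  have hx : (Abelian.Ext.mk₀ (ModuleCat.ofHom f₁)).comp
      ((Abelian.Ext.mk₀ (ModuleCat.ofHom g₁)).comp x (zero_add i)) (zero_add i) +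
      (Abelian.Ext.mk₀ (ModuleCat.ofHom f₂)).comp
      ((Abelian.Ext.mk₀ (ModuleCat.ofHom g₂)).comp x (zero_add i)) (zero_add i) = x := by
    rw [Abelian.Ext.mk₀_comp_mk₀_assoc, Abelian.Ext.mk₀_comp_mk₀_assoc, ← Abelian.Ext.add_comp,
      ← Abelian.Ext.mk₀_add, ← ModuleCat.ofHom_comp, ← ModuleCat.ofHom_comp,
      ← ModuleCat.ofHom_add, h, ModuleCat.ofHom_id, Abelian.Ext.mk₀_id_comp]
  rw [← hx, Subsingleton.elim ((Abelian.Ext.mk₀ (ModuleCat.ofHom g₁)).comp x (zero_add i)) 0,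
    Subsingleton.elim ((Abelian.Ext.mk₀ (ModuleCat.ofHom g₂)).comp x (zero_add i)) 0,
    Abelian.Ext.comp_zero, Abelian.Ext.comp_zero, add_zero]

lemma subsingleton_modExt_succ_of_projective [Module.Projective A M] (i : ℕ) :
    Subsingleton (ModExt A M N (i + 1)) :=
  have := (IsProjective.iff_projective (R := A) M).1 inferInstance
  subsingleton_of_forall_eq 0 fun _ => Abelian.Ext.eq_zero_of_projective _

lemma subsingleton_modExt_of_subsingleton [Subsingleton M] (i : ℕ) :
    Subsingleton (ModExt A M N i) := by
  refine subsingleton_of_forall_eq 0 fun x => ?_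
  rw [← Abelian.Ext.mk₀_id_comp x, (ModuleCat.isZero_of_subsingleton
    (ModuleCat.of A M)).eq_of_src (𝟙 _) 0, Abelian.Ext.mk₀_zero, Abelian.Ext.zero_comp]

variable {φ : M →ₗ[A] M'}

lemma subsingleton_modExt_ker [Module.Projective A M] (hφ : Function.Surjective φ) {i : ℕ}
    (h : Subsingleton (ModExt A M' N (i + 2))) :
    Subsingleton (ModExt A (LinearMap.ker φ) N (i + 1)) := by
  refine subsingleton_of_forall_eq 0 fun x => ?_
  obtain ⟨y, rfl⟩ := Abelian.Ext.contravariant_sequence_exact₁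
    (LinearMap.shortExact_shortComplexKer hφ) _ x (n₁ := i + 2) (by lia) (Subsingleton.elim _ _)
  rw [(subsingleton_modExt_succ_of_projective (A := A) (M := M) (N := N) i).elim y 0,
    Abelian.Ext.comp_zero]

lemma subsingleton_modExt_of_ker_of_projective [Module.Projective A M]
    (hφ : Function.Surjective φ) {i : ℕ}
    (h : Subsingleton (ModExt A (LinearMap.ker φ) N i)) :
    Subsingleton (ModExt A M' N (i + 1)) := by
  have : Projective (φ.shortComplexKer).X₂ :=
    (IsProjective.iff_projective (R := A) M).1 inferInstance
  exact (precomp_extClass_surjective_of_projective_X₂ (ModuleCat.of A N)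
    (LinearMap.shortExact_shortComplexKer hφ) i).subsingleton

lemma subsingleton_modExt_middle (hφ : Function.Surjective φ) {i : ℕ}
    (h₁ : Subsingleton (ModExt A (LinearMap.ker φ) N i))
    (h₂ : Subsingleton (ModExt A M' N i)) :
    Subsingleton (ModExt A M N i) := by
  refine subsingleton_of_forall_eq 0 fun x => ?_
  obtain ⟨y, rfl⟩ := Abelian.Ext.contravariant_sequence_exact₂
    (LinearMap.shortExact_shortComplexKer hφ) _ x (h₁.elim _ _)
  rw [h₂.elim y 0, Abelian.Ext.comp_zero]

lemma exists_precomp_eq_of_ker (hφ : Function.Surjective φ) {i : ℕ}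
    (h : Subsingleton (ModExt A M' N (i + 1))) (x : ModExt A (LinearMap.ker φ) N i) :
    ∃ y : ModExt A M N i,
      (Abelian.Ext.mk₀ (ModuleCat.ofHom (LinearMap.ker φ).subtype)).comp y (zero_add i) = x :=
  Abelian.Ext.contravariant_sequence_exact₁
    (LinearMap.shortExact_shortComplexKer hφ) _ x (n₁ := i + 1) (by lia) (h.elim _ _)

lemma exists_extension_of_subsingleton_modExt_one (hφ : Function.Surjective φ)
    (h : Subsingleton (ModExt A M' N 1)) (f : LinearMap.ker φ →ₗ[A] N) :
    ∃ g : M →ₗ[A] N, ∀ x : LinearMap.ker φ, g x = f x := by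
  obtain ⟨y, hy⟩ := exists_precomp_eq_of_ker hφ (i := 0) h (Abelian.Ext.mk₀ (ModuleCat.ofHom f))
  obtain ⟨y, rfl⟩ := Abelian.Ext.homEquiv₀.symm.surjective y
  refine ⟨y.hom, fun x => ?_⟩
  have hy' : Abelian.Ext.mk₀ (ModuleCat.ofHom (LinearMap.ker φ).subtype ≫ y) =
      Abelian.Ext.mk₀ (ModuleCat.ofHom f) := by
    rw [← hy, ← Abelian.Ext.mk₀_comp_mk₀]
    rfl
  have := Abelian.Ext.homEquiv₀.symm.injective hy'
  exact LinearMap.congr_fun (congrArg ModuleCat.Hom.hom this) x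

end ExtLemmas

section InjectiveDimension

variable {A : Type} [CommRing A]

lemma hasInjectiveDimensionLT_of_subsingleton_modExt_quotient (n : ℕ) (N : Type) [AddCommGroup N]
    [Module A N] (h : ∀ I : Ideal A, Subsingleton (ModExt A (A ⧸ I) N (n + 1))) :
    HasInjectiveDimensionLT (ModuleCat.of A N) (n + 1) := by
  induction n generalizing N with
  | zero =>
    rw [zero_add, ← injective_iff_hasInjectiveDimensionLT_one,
      ← Module.injective_iff_injective_object, ← Module.Baer.iff_injective]
    intro I f
    obtain ⟨g, hg⟩ := exists_extension_of_subsingleton_modExt_one (φ := I.mkQ)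
      I.mkQ_surjective (h I) (f ∘ₗ (LinearEquiv.ofEq _ _ I.ker_mkQ).toLinearMap)
    exact ⟨g, fun x hx => hg ⟨x, by simpa using hx⟩⟩
  | succ n ih =>
    let ⟨E, _, f, _⟩ := EnoughInjectives.presentation (ModuleCat.of A N)
    have injf : Function.Injective f.hom := (ModuleCat.mono_iff_injective f).mp ‹_›
    let S : ShortComplex (ModuleCat.{0} A) :=
      ModuleCat.shortComplexOfCompEqZero _ _ f.hom.exact_map_mkQ_range.linearMap_comp_eq_zero
    have hS : S.ShortExact := ModuleCat.shortComplex_shortExact S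
      f.hom.exact_map_mkQ_range injf (Submodule.mkQ_surjective _)
    have : Injective S.X₂ := inferInstanceAs (Injective E)
    refine (hS.hasInjectiveDimensionLT_X₃_iff n inferInstance).1 (ih _ fun I => ?_)
    refine subsingleton_of_forall_eq 0 fun x => ?_
    obtain ⟨y, rfl⟩ := Abelian.Ext.covariant_sequence_exact₃ _ hS x (n₁ := n + 2) rfl
      ((h I).elim _ _)
    rw [Abelian.Ext.eq_zero_of_injective y, Abelian.Ext.zero_comp]

variable [IsLocalRing A] [IsNoetherianRing A]

lemma subsingleton_modExt_quotient_of_residue {N : Type} [AddCommGroup N] [Module A N]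
    [Module.Finite A N] {n : ℕ}
    (h : ∀ i ≥ n, Subsingleton (ModExt A (A ⧸ maximalIdeal A) N i)) (I : Ideal A) :
    ∀ i ≥ n, Subsingleton (ModExt A (A ⧸ I) N i) := by
  induction I using WellFoundedGT.induction with
  | _ I ih =>
  intro i hi
  by_cases htop : I = ⊤
  · have : Subsingleton (A ⧸ I) := Submodule.Quotient.subsingleton_iff.2 htop
    exact subsingleton_modExt_of_subsingleton i
  by_cases hm : I = maximalIdeal A
  · exact hm ▸ h i hi
  obtain ⟨x, hxm, hxI⟩ := SetLike.exists_of_lt (lt_of_le_of_ne (le_maximalIdeal htop) hm)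
  have hlt : I < I ⊔ Ideal.span {x} := by
    refine lt_of_le_of_ne le_sup_left fun he => hxI ?_
    rw [he]
    exact Ideal.mem_sup_right (Ideal.mem_span_singleton_self x)
  let φ : (A ⧸ I) →ₗ[A] (A ⧸ (I ⊔ Ideal.span {x})) := Submodule.factor le_sup_left
  have hφ : Function.Surjective φ := Submodule.factor_surjective _
  let ψ : A →ₗ[A] (A ⧸ I) := LinearMap.toSpanSingleton A _ (I.mkQ x)
  have hker : LinearMap.ker φ = LinearMap.range ψ := by
    ext y
    obtain ⟨a, rfl⟩ := I.mkQ_surjective y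
    change (Submodule.Quotient.mk a : A ⧸ (I ⊔ Ideal.span {x})) = 0 ↔ _
    simp only [ψ, Submodule.mkQ_apply, Submodule.Quotient.mk_eq_zero, LinearMap.mem_range,
      LinearMap.toSpanSingleton_apply, ← Submodule.Quotient.mk_smul, Submodule.Quotient.eq,
      Submodule.mem_sup, Ideal.mem_span_singleton', smul_eq_mul]
    constructor
    · rintro ⟨b, hb, _, ⟨c, rfl⟩, rfl⟩
      exact ⟨c, by simpa using neg_mem hb⟩
    · rintro ⟨c, hc⟩
      exact ⟨a - c * x, by simpa using neg_mem hc, _, ⟨c, rfl⟩, by ring⟩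
  let e : (A ⧸ LinearMap.ker ψ) ≃ₗ[A] LinearMap.ker φ :=
    ψ.quotKerEquivRange.trans (LinearEquiv.ofEq _ _ hker.symm)
  have hle : I ≤ LinearMap.ker ψ := by
    intro a ha
    simp only [ψ, LinearMap.mem_ker, LinearMap.toSpanSingleton_apply, Submodule.mkQ_apply,
      ← Submodule.Quotient.mk_smul, Submodule.Quotient.mk_eq_zero, smul_eq_mul]
    exact I.mul_mem_right _ ha
  rcases eq_or_lt_of_le hle with heq | hlt'
  · let e' : (A ⧸ I) ≃ₗ[A] LinearMap.ker φ := (Submodule.quotEquivOfEq _ _ heq).trans e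
    have he' : (LinearMap.ker φ).subtype ∘ₗ e'.toLinearMap = x • LinearMap.id := by
      refine Submodule.linearMap_qext _ (LinearMap.ext_ring ?_)
      change ψ 1 = x • I.mkQ 1
      rw [LinearMap.toSpanSingleton_apply_one, ← map_smul, smul_eq_mul, mul_one]
    have hsurj (y : ModExt A (A ⧸ I) N i) : ∃ z : ModExt A (A ⧸ I) N i, x • z = y := by
      obtain ⟨z, hz⟩ := exists_precomp_eq_of_ker hφ (ih _ hlt (i + 1) (by lia))
        ((Abelian.Ext.mk₀ (ModuleCat.ofHom e'.symm.toLinearMap)).comp y (zero_add i))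
      refine ⟨z, ?_⟩
      have := congrArg (fun w => (Abelian.Ext.mk₀ (ModuleCat.ofHom e'.toLinearMap)).comp w
        (zero_add i)) hz
      rw [Abelian.Ext.mk₀_comp_mk₀_assoc, Abelian.Ext.mk₀_comp_mk₀_assoc, ← ModuleCat.ofHom_comp,
        ← ModuleCat.ofHom_comp, he', LinearEquiv.symm_comp, ModuleCat.ofHom_id,
        Abelian.Ext.mk₀_id_comp] at this
      rw [← this, show ModuleCat.ofHom (x • LinearMap.id) = x • 𝟙 (ModuleCat.of A (A ⧸ I)) from
        rfl, Abelian.Ext.mk₀_smul, Abelian.Ext.smul_comp, Abelian.Ext.mk₀_id_comp]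
    refine (Submodule.subsingleton_iff A).1 (subsingleton_of_bot_eq_top (Eq.symm ?_))
    refine Submodule.eq_bot_of_le_smul_of_le_jacobson_bot (maximalIdeal A) _
      (Module.finite_def.1 inferInstance) (fun y _ => ?_) (maximalIdeal_le_jacobson _)
    obtain ⟨z, rfl⟩ := hsurj y
    exact Submodule.smul_mem_smul hxm trivial
  · exact subsingleton_modExt_middle hφ (subsingleton_modExt_of_retract e.symm.toLinearMap
      e.toLinearMap (by simp) (ih _ hlt' i hi)) (ih _ hlt i hi)

lemma idLE_of_subsingleton_modExt_residue {N : Type} [AddCommGroup N] [Module A N]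
    [Module.Finite A N] {n : ℕ}
    (h : ∀ i > n, Subsingleton (ModExt A (A ⧸ maximalIdeal A) N i)) : IdLE A N n := by
  have := hasInjectiveDimensionLT_of_subsingleton_modExt_quotient n N fun I =>
    subsingleton_modExt_quotient_of_residue h I (n + 1) le_rfl
  intro X i hi
  obtain ⟨i, rfl⟩ : ∃ j, i = j + 1 := ⟨i - 1, by lia⟩
  exact (subsingleton_ext_succ_iff _ _ i).2
    (HasInjectiveDimensionLT.subsingleton _ (n + 1) (i + 1) (by lia) X)

end InjectiveDimension

section MinimalCover

variable {A : Type} [CommRing A] [IsLocalRing A] {M : Type} [AddCommGroup M] [Module A M]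

variable (A M) in
lemma exists_minimal_cover [Module.Finite A M] :
    ∃ (n : ℕ) (φ : (Fin n → A) →ₗ[A] M), Function.Surjective φ ∧
      ∀ x ∈ LinearMap.ker φ, ∀ i, x i ∈ maximalIdeal A := by
  classical
  have hex : ∃ (n : ℕ) (φ : (Fin n → A) →ₗ[A] M), Function.Surjective φ :=
    Module.Finite.exists_fin' A M
  obtain ⟨φ, hφ⟩ := Nat.find_spec hex
  refine ⟨_, φ, hφ, fun x hx i => ?_⟩
  by_contra hxi
  obtain ⟨m, hm⟩ : ∃ m, Nat.find hex = m + 1 := Nat.exists_eq_succ_of_ne_zero i.pos.ne'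
  refine Nat.find_min hex (m := m) (by lia) ?_
  generalize Nat.find hex = n at hm φ i x
  subst hm
  obtain ⟨u, hu⟩ := (notMem_maximalIdeal.1 hxi).exists_left_inv
  let g : (Fin m → A) →ₗ[A] (Fin (m + 1) → A) :=
    LinearMap.pi (i.insertNth 0 fun l => LinearMap.proj l)
  refine ⟨φ ∘ₗ g, fun y => ?_⟩
  obtain ⟨z, rfl⟩ := hφ y
  refine ⟨fun l => (z - (z i * u) • x) (i.succAbove l), ?_⟩
  have hg : g (fun l => (z - (z i * u) • x) (i.succAbove l)) = z - (z i * u) • x := by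
    ext j
    refine Fin.succAboveCases i ?_ (fun l => ?_) j
    · simp [g, mul_assoc, hu]
    · simp [g]
  rw [LinearMap.comp_apply, hg, map_sub, map_smul, LinearMap.mem_ker.1 hx, smul_zero, sub_zero]

lemma map_mem_maximalIdeal_smul_top {n : ℕ} (g : (Fin n → A) →ₗ[A] M) {x : Fin n → A}
    (hx : ∀ i, x i ∈ maximalIdeal A) : g x ∈ maximalIdeal A • (⊤ : Submodule A M) := by
  rw [LinearMap.pi_apply_eq_sum_univ]
  exact Submodule.sum_mem _ fun i _ => Submodule.smul_mem_smul (hx i) trivial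

end MinimalCover

/-- The vanishing of `Ext^i_A(M, N)` for all `i ≥ 1`. -/
abbrev ModExtVanish (A : Type) [CommRing A] (M N : Type) [AddCommGroup M] [Module A M]
    [AddCommGroup N] [Module A N] : Prop :=
  ∀ i : ℕ, Subsingleton (ModExt A M N (i + 1))

lemma mul_eq_zero_of_inf_eq_bot {A : Type*} [CommRing A] {I J : Ideal A}
    (hinf : I ⊓ J = ⊥) {a b : A} (ha : a ∈ I) (hb : b ∈ J) :
    a * b = 0 := by
  have : a * b ∈ I ⊓ J := ⟨I.mul_mem_right _ ha, J.mul_mem_left _ hb⟩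
  rwa [hinf] at this

lemma nonempty_linearEquiv_self_of_bijective_lsmul {A M : Type*} [CommRing A] [Nontrivial A]
    [AddCommGroup M] [Module A M] {n : ℕ} (e : (Fin n → A) ≃ₗ[A] M)
    (h : Function.Bijective (LinearMap.lsmul A M)) :
    Nonempty (M ≃ₗ[A] A) := by
  match n, e with
  | 0, e =>
    have : Subsingleton M := e.symm.injective.subsingleton
    exact (one_ne_zero (α := A) (h.1 (LinearMap.ext fun _ => Subsingleton.elim _ _))).elim
  | 1, e => exact ⟨e.symm.trans (LinearEquiv.funUnique (Fin 1) A A)⟩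
  | n + 2, e =>
    obtain ⟨a, ha⟩ := h.2 (e.toLinearMap ∘ₗ LinearMap.single A (fun _ => A) 0 ∘ₗ
      LinearMap.proj 0 ∘ₗ e.symm.toLinearMap)
    have key (y : Fin (n + 2) → A) : a • y = Pi.single 0 (y 0) := e.injective <| by
      simpa using LinearMap.congr_fun ha (e y)
    have h₀ : a = 1 := by simpa using congrFun (key (Pi.single 0 1)) 0
    have h₁ : a = 0 := by simpa using congrFun (key (Pi.single 1 1)) 1
    exact (one_ne_zero (h₀.symm.trans h₁)).elim

section DecomposableMaximalIdeal

variable {A : Type} [CommRing A] [IsLocalRing A] {I J : Ideal A}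

lemma exists_projection_of_sup_eq (hsup : I ⊔ J = maximalIdeal A) (hinf : I ⊓ J = ⊥) :
    ∃ q : maximalIdeal A →ₗ[A] J, ∀ x : maximalIdeal A, (x : A) - q x ∈ I := by
  let f : (I × J) →ₗ[A] A := I.subtype.coprod J.subtype
  have hf : Function.Injective f := by
    refine (injective_iff_map_eq_zero f).2 fun ⟨a, b⟩ hab => ?_
    have hab : (a : A) + b = 0 := hab
    have ha : (a : A) ∈ I ⊓ J := ⟨a.2, by rw [eq_neg_of_add_eq_zero_left hab]; exact neg_mem b.2⟩
    rw [hinf, Ideal.mem_bot] at ha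
    rw [ha, zero_add] at hab
    ext <;> assumption
  have hrange : LinearMap.range f = maximalIdeal A := by
    rw [← hsup, LinearMap.range_coprod, Submodule.range_subtype, Submodule.range_subtype]
  let e := (LinearEquiv.ofInjective f hf).trans (LinearEquiv.ofEq _ _ hrange)
  refine ⟨LinearMap.snd A I J ∘ₗ e.symm.toLinearMap, fun x => ?_⟩
  obtain ⟨⟨a, b⟩, rfl⟩ := e.surjective x
  have : ((e (a, b) : maximalIdeal A) : A) = a + b := rfl
  simp [this]

lemma projection_apply_of_mem (hinf : I ⊓ J = ⊥) {q : maximalIdeal A →ₗ[A] J}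
    (hq : ∀ x : maximalIdeal A, (x : A) - q x ∈ I) (x : maximalIdeal A) (hx : (x : A) ∈ J) :
    (q x : A) = x := by
  have : (x : A) - q x ∈ I ⊓ J := ⟨hq x, sub_mem hx (q x).2⟩
  rw [hinf, Ideal.mem_bot, sub_eq_zero] at this
  exact this.symm

variable {M N : Type} [AddCommGroup M] [Module A M] [AddCommGroup N] [Module A N]

lemma modExtVanish_ideal_of_annihilates (hsup : I ⊔ J = maximalIdeal A) (hinf : I ⊓ J = ⊥)
    [Module.Finite A M] [Nontrivial M] (hM : ∀ a ∈ J, ∀ m : M, a • m = 0)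
    (h : ModExtVanish A M N) : ModExtVanish A J N := by
  obtain ⟨q, hq⟩ := exists_projection_of_sup_eq hsup hinf
  obtain ⟨n, φ, hφ, hker⟩ := exists_minimal_cover A M
  obtain rfl | ⟨n, rfl⟩ : n = 0 ∨ ∃ m, n = m + 1 := by cases n <;> simp
  · exact (not_subsingleton M hφ.subsingleton).elim
  let f : J →ₗ[A] LinearMap.ker φ :=
    (LinearMap.single A (fun _ : Fin (n + 1) => A) 0 ∘ₗ J.subtype).codRestrict _ fun a => by
      have : Pi.single (M := fun _ : Fin (n + 1) => A) 0 (a : A) =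
        (a : A) • Pi.single 0 1 := by rw [← Pi.single_smul, smul_eq_mul, mul_one]
      simp [this, hM a a.2]
  let g : LinearMap.ker φ →ₗ[A] J :=
    q ∘ₗ (LinearMap.proj 0 ∘ₗ (LinearMap.ker φ).subtype).codRestrict _ fun x => hker x x.2 0
  refine fun i => subsingleton_modExt_of_retract f g ?_ (subsingleton_modExt_ker hφ (h (i + 1)))
  ext a
  have hfa : (f a : Fin (n + 1) → A) 0 = a := by
    change LinearMap.single A (fun _ : Fin (n + 1) => A) 0 (a : A) 0 = a
    rw [LinearMap.single_apply, Pi.single_eq_same]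
  exact (projection_apply_of_mem hinf hq ⟨(f a : Fin (n + 1) → A) 0, hker _ (f a).2 0⟩
    (hfa.symm.subst (motive := (· ∈ J)) a.2)).trans hfa

lemma modExtVanish_ideal_of_ker [IsNoetherianRing A] (hsup : I ⊔ J = maximalIdeal A)
    (hinf : I ⊓ J = ⊥) {m n : ℕ} (ψ : (Fin m → A) →ₗ[A] (Fin n → A))
    (hψ : ∀ x ∈ LinearMap.ker ψ, ∀ i, x i ∈ maximalIdeal A)
    (h : ModExtVanish A (LinearMap.ker ψ) N) {x : Fin m → A} (hx : x ∈ LinearMap.ker ψ)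
    {i : Fin m} (hxi : x i ∉ I) : ModExtVanish A I N := by
  obtain ⟨q, hq⟩ := exists_projection_of_sup_eq hsup hinf
  let L : Submodule A (Fin m → A) := LinearMap.ker ψ ⊓ Submodule.pi Set.univ fun _ => J
  have hmap (K : Ideal A) (y : Fin m → A) (hy : ∀ i, y i ∈ K) (j : Fin n) : ψ y j ∈ K := by
    rw [LinearMap.pi_apply_eq_sum_univ, Finset.sum_apply]
    exact K.sum_mem fun l _ => K.mul_mem_right _ (hy l)
  let g₀ : LinearMap.ker ψ →ₗ[A] (Fin m → A) := LinearMap.pi fun l => J.subtype ∘ₗ q ∘ₗ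
    (LinearMap.proj l ∘ₗ (LinearMap.ker ψ).subtype).codRestrict _ fun y => hψ y y.2 l
  have hg₀ (y : LinearMap.ker ψ) : g₀ y ∈ L := by
    have hJ (l : Fin m) : g₀ y l ∈ J := Subtype.prop (p := (· ∈ J)) (q _)
    refine ⟨?_, fun l _ => hJ l⟩
    ext j
    have h₁ : ψ ((y : Fin m → A) - g₀ y) j ∈ I :=
      hmap I ((y : Fin m → A) - g₀ y) (fun l => hq ⟨_, hψ y y.2 l⟩) j
    rw [map_sub, LinearMap.mem_ker.1 y.2, zero_sub, Pi.neg_apply, neg_mem_iff] at h₁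
    have : ψ (g₀ y) j ∈ I ⊓ J := ⟨h₁, hmap J _ hJ j⟩
    rwa [hinf] at this
  have hL : ModExtVanish A L N := fun l => subsingleton_modExt_of_retract
    (Submodule.inclusion inf_le_left) (g₀.codRestrict L hg₀) (by
      ext y l
      exact projection_apply_of_mem hinf hq _ (y.2.2 l trivial)) (h l)
  have : Nontrivial L := by
    refine ⟨⟨g₀.codRestrict L hg₀ ⟨x, hx⟩, 0, fun h0 => hxi ?_⟩⟩
    have h0 : g₀ ⟨x, hx⟩ i = 0 := congrFun (congrArg Subtype.val h0) i
    have hxq : x i - g₀ ⟨x, hx⟩ i ∈ I := hq ⟨x i, hψ x hx i⟩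
    rwa [h0, sub_zero] at hxq
  refine modExtVanish_ideal_of_annihilates (sup_comm I J ▸ hsup) (inf_comm I J ▸ hinf) ?_ hL
  intro a ha y
  ext l
  exact mul_eq_zero_of_inf_eq_bot hinf ha (y.2.2 l trivial)

lemma ModExtVanish.ideal_of_ideal [IsNoetherianRing A] (hsup : I ⊔ J = maximalIdeal A)
    (hinf : I ⊓ J = ⊥) (hI : I ≠ ⊥) (h : ModExtVanish A I N) : ModExtVanish A J N :=
  have : Nontrivial I := Submodule.nontrivial_iff_ne_bot.2 hI
  modExtVanish_ideal_of_annihilates hsup hinf (fun a ha b => Subtype.ext <|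
    (mul_comm a b).trans (mul_eq_zero_of_inf_eq_bot hinf b.2 ha)) h

lemma idLE_one_of_modExtVanish [IsNoetherianRing A] [Module.Finite A N]
    (hsup : I ⊔ J = maximalIdeal A) (hinf : I ⊓ J = ⊥) (hI : ModExtVanish A I N)
    (hJ : ModExtVanish A J N) : IdLE A N 1 := by
  obtain ⟨q, hq⟩ := exists_projection_of_sup_eq hsup hinf
  have hIm : I ≤ maximalIdeal A := hsup ▸ le_sup_left
  have hJm : J ≤ maximalIdeal A := hsup ▸ le_sup_right
  let p : maximalIdeal A →ₗ[A] I :=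
    ((maximalIdeal A).subtype - J.subtype ∘ₗ q).codRestrict _ hq
  refine idLE_of_subsingleton_modExt_residue fun i hi => ?_
  obtain ⟨i, rfl⟩ : ∃ j, i = j + 1 + 1 := ⟨i - 2, by lia⟩
  have hm : Subsingleton (ModExt A (maximalIdeal A) N (i + 1)) :=
    subsingleton_modExt_of_sum p (Submodule.inclusion hIm) q (Submodule.inclusion hJm)
      (by ext x; exact sub_add_cancel _ _) (hI i) (hJ i)
  exact subsingleton_modExt_of_ker_of_projective (maximalIdeal A).mkQ_surjective
    ((Submodule.ker_mkQ (maximalIdeal A)).symm ▸ hm)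

theorem nonempty_linearEquiv_or_idLE_one [IsNoetherianRing A] [Module.Finite A M]
    (hsup : I ⊔ J = maximalIdeal A) (hinf : I ⊓ J = ⊥) (hI : I ≠ ⊥) (hJ : J ≠ ⊥)
    (hhom : Function.Bijective (LinearMap.lsmul A M)) (hM : ModExtVanish A M M) :
    Nonempty (M ≃ₗ[A] A) ∨ IdLE A M 1 := by
  have hnt : Nontrivial M := by
    by_contra hM
    rw [not_nontrivial_iff_subsingleton] at hM
    exact one_ne_zero (α := A) (hhom.1 (LinearMap.ext fun _ => Subsingleton.elim _ _))
  obtain ⟨n, φ, hφ, hker⟩ := exists_minimal_cover A M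
  obtain ⟨m, ψ, hψ, hkerψ⟩ := exists_minimal_cover A (LinearMap.ker φ)
  have hK : ModExtVanish A (LinearMap.ker φ) M := fun i => subsingleton_modExt_ker hφ (hM (i + 1))
  have hL : ModExtVanish A (LinearMap.ker ψ) M := fun i => subsingleton_modExt_ker hψ (hK (i + 1))
  have hker_eq : LinearMap.ker ((LinearMap.ker φ).subtype ∘ₗ ψ) = LinearMap.ker ψ :=
    LinearMap.ker_comp_of_ker_eq_bot _ (Submodule.ker_subtype _)
  by_cases hinj : LinearMap.ker ψ = ⊥
  · left
    let e := LinearEquiv.ofBijective ψ ⟨LinearMap.ker_eq_bot.1 hinj, hψ⟩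
    obtain rfl | ⟨m, rfl⟩ : m = 0 ∨ ∃ l, m = l + 1 := by cases m <;> simp
    · have : Subsingleton (LinearMap.ker φ) := hψ.subsingleton
      exact nonempty_linearEquiv_self_of_bijective_lsmul (LinearEquiv.ofBijective φ
        ⟨LinearMap.ker_eq_bot.1 (Submodule.subsingleton_iff_eq_bot.1 this), hφ⟩) hhom
    · exfalso
      obtain ⟨c, hc⟩ : ∃ c, c ∉ maximalIdeal A • (⊤ : Submodule A M) := by
        by_contra! hc
        exact top_ne_bot (Submodule.eq_bot_of_le_smul_of_le_jacobson_bot (maximalIdeal A)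
          (⊤ : Submodule A M) (Module.finite_def.1 inferInstance) (fun c _ => hc c)
          (maximalIdeal_le_jacobson _))
      obtain ⟨g, hg⟩ := exists_extension_of_subsingleton_modExt_one hφ (hM 0)
        (LinearMap.toSpanSingleton A M c ∘ₗ LinearMap.proj 0 ∘ₗ e.symm.toLinearMap)
      refine hc ?_
      have := hg (e (Pi.single 0 1))
      simp only [LinearMap.comp_apply, LinearEquiv.coe_coe, LinearEquiv.symm_apply_apply,
        LinearMap.proj_apply, Pi.single_eq_same, LinearMap.toSpanSingleton_apply, one_smul] at this
      rw [← this]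
      exact map_mem_maximalIdeal_smul_top g (hker _ (e _).2)
  · right
    obtain ⟨x, hx, hx0⟩ := (Submodule.ne_bot_iff _).1 hinj
    obtain ⟨i, hi⟩ := Function.ne_iff.1 hx0
    rw [← hker_eq] at hx hkerψ hL
    by_cases hxi : x i ∈ I
    · have hxj : x i ∉ J := fun hxj => hi (by simpa [hinf] using show x i ∈ I ⊓ J from ⟨hxi, hxj⟩)
      have h := modExtVanish_ideal_of_ker (sup_comm I J ▸ hsup) (inf_comm I J ▸ hinf) _ hkerψ hL
        hx hxj
      exact idLE_one_of_modExtVanish hsup hinf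
        (h.ideal_of_ideal (sup_comm I J ▸ hsup) (inf_comm I J ▸ hinf) hJ) h
    · have h := modExtVanish_ideal_of_ker hsup hinf _ hkerψ hL hx hxi
      exact idLE_one_of_modExtVanish hsup hinf h (h.ideal_of_ideal hsup hinf hI)

end DecomposableMaximalIdeal

section FiberProduct

variable {S T k : Type} [CommRing S] [CommRing T]

lemma isNoetherianRing_fiberProd [CommRing k] [IsNoetherianRing S] [IsNoetherianRing T]
    {πS : S →+* k} {πT : T →+* k} (hπS : Function.Surjective πS) (hπT : Function.Surjective πT) :
    IsNoetherianRing (fiberProd πS πT) := by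
  let _ : Module (fiberProd πS πT) S := Module.compHom S (ρS πS πT)
  let _ : Module (fiberProd πS πT) T := Module.compHom T (ρT πS πT)
  have : RingHomSurjective (ρS πS πT) := ⟨πS.surjective_pullbackFst_of_surjective πT hπT⟩
  have : RingHomSurjective (ρT πS πT) := ⟨πS.surjective_pullbackSnd_of_surjective πT hπS⟩
  let eS : S →ₛₗ[ρS πS πT] S :=
    { toFun := id, map_add' := fun _ _ => rfl, map_smul' := fun _ _ => rfl }
  let eT : T →ₛₗ[ρT πS πT] T :=
    { toFun := id, map_add' := fun _ _ => rfl, map_smul' := fun _ _ => rfl }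
  have : IsNoetherian (fiberProd πS πT) S :=
    (LinearMap.isNoetherian_iff_of_bijective eS Function.bijective_id).2 inferInstance
  have : IsNoetherian (fiberProd πS πT) T :=
    (LinearMap.isNoetherian_iff_of_bijective eT Function.bijective_id).2 inferInstance
  let f : fiberProd πS πT →ₗ[fiberProd πS πT] S × T :=
    { toFun := Subtype.val, map_add' := fun _ _ => rfl, map_smul' := fun _ _ => rfl }
  exact isNoetherian_of_injective f Subtype.val_injective

variable [Field k] {πS : S →+* k} {πT : T →+* k}

lemma ker_inf_ker_fiberProd : RingHom.ker (ρT πS πT) ⊓ RingHom.ker (ρS πS πT) = ⊥ :=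
  eq_bot_iff.2 fun _ hx => Subtype.ext (Prod.ext hx.2 hx.1)

lemma ker_ρT_ne_bot [IsLocalRing S] (hkS : RingHom.ker πS = maximalIdeal S)
    (hS : maximalIdeal S ≠ ⊥) :
    RingHom.ker (ρT πS πT) ≠ ⊥ := by
  obtain ⟨s, hs, hs0⟩ := (Submodule.ne_bot_iff _).1 hS
  rw [← hkS] at hs
  exact (Submodule.ne_bot_iff _).2 ⟨⟨(s, 0), hs.trans (map_zero πT).symm⟩, rfl,
    fun h => hs0 (congrArg (fun x => x.1.1) h)⟩

lemma ker_ρS_ne_bot [IsLocalRing T] (hkT : RingHom.ker πT = maximalIdeal T)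
    (hT : maximalIdeal T ≠ ⊥) :
    RingHom.ker (ρS πS πT) ≠ ⊥ := by
  obtain ⟨t, ht, ht0⟩ := (Submodule.ne_bot_iff _).1 hT
  rw [← hkT] at ht
  exact (Submodule.ne_bot_iff _).2 ⟨⟨(0, t), (map_zero πS).trans ht.symm⟩, rfl,
    fun h => ht0 (congrArg (fun x => x.1.2) h)⟩

variable [IsLocalRing T]

lemma isLocalHom_of_ker_eq_maximalIdeal (hkT : RingHom.ker πT = maximalIdeal T) :
    IsLocalHom πT where
  map_nonunit a ha := by
    rw [← notMem_maximalIdeal, ← hkT, RingHom.mem_ker]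
    exact ha.ne_zero

lemma ker_sup_ker_fiberProd [IsLocalRing S] [IsLocalRing (fiberProd πS πT)]
    (hkS : RingHom.ker πS = maximalIdeal S) (hkT : RingHom.ker πT = maximalIdeal T) :
    RingHom.ker (ρT πS πT) ⊔ RingHom.ker (ρS πS πT) = maximalIdeal (fiberProd πS πT) := by
  refine le_antisymm (sup_le (le_maximalIdeal (RingHom.ker_ne_top _))
    (le_maximalIdeal (RingHom.ker_ne_top _))) fun x hx => ?_
  have := isLocalHom_of_ker_eq_maximalIdeal hkT
  have hx₁ : πS x.1.1 = 0 := by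
    have hlocal : IsLocalHom (ρS πS πT) := πS.isLocalHom_pullbackFst πT
    rw [← RingHom.mem_ker, hkS]
    exact fun h => hx (hlocal.map_nonunit _ h)
  have hx₂ : πT x.1.2 = 0 := Eq.trans (Eq.symm x.2) hx₁
  refine Submodule.mem_sup.2 ⟨⟨(x.1.1, 0), hx₁.trans (map_zero πT).symm⟩, rfl,
    ⟨(0, x.1.2), (map_zero πS).trans hx₂.symm⟩, rfl, ?_⟩
  ext <;> simp

end FiberProduct

/-- Corollary 4.6 (module case): if `C` is a semidualizing module over the fiber product
`R = S ×ₖ T` (the homothety map `R → Hom_R(C,C)` is bijective and `Ext^i_R(C,C) = 0` for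
`i ≥ 1`), then `C ≅ R` or `C` has finite injective dimension (i.e. `C` is dualizing). -/
theorem stmt_19 (S T k : Type) [CommRing S] [CommRing T] [Field k]
    [IsNoetherianRing S] [IsNoetherianRing T] [IsLocalRing S] [IsLocalRing T]
    (πS : S →+* k) (πT : T →+* k)
    (hπS : Function.Surjective πS) (hπT : Function.Surjective πT)
    (hkS : RingHom.ker πS = maximalIdeal S) (hkT : RingHom.ker πT = maximalIdeal T)
    (hS : maximalIdeal S ≠ ⊥) (hT : maximalIdeal T ≠ ⊥)
    (C : Type) [AddCommGroup C] [Module ↥(fiberProd πS πT) C]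
    [Module.Finite ↥(fiberProd πS πT) C]
    (hhom : Function.Bijective (LinearMap.lsmul ↥(fiberProd πS πT) C))
    (hext : ∀ i ≥ 1, ExtZero ↥(fiberProd πS πT) C C i) :
    Nonempty (C ≃ₗ[↥(fiberProd πS πT)] ↥(fiberProd πS πT)) ∨
      ∃ n : ℕ, IdLE ↥(fiberProd πS πT) C n := by
  have := isLocalHom_of_ker_eq_maximalIdeal hkT
  have : IsLocalRing (fiberProd πS πT) := πS.isLocalRing_pullback πT
  have := isNoetherianRing_fiberProd hπS hπT
  refine (nonempty_linearEquiv_or_idLE_one (ker_sup_ker_fiberProd hkS hkT) ker_inf_ker_fiberProd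
    (ker_ρT_ne_bot hkS hS) (ker_ρS_ne_bot hkT hT) hhom fun i =>
      (subsingleton_ext_succ_iff _ _ i).1 (hext (i + 1) (by lia))).imp id fun h => ⟨1, h⟩
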